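/- Let Φ_α^{R,δ,μ} be the Poisson-Poisson cluster point process on ℝ² with annular clusters: a Cox point process whose random driving intensity measure is Λ(·) = μ Σ_{X ∈ Φ_α} 𝒳(X, · − X), where Φ_α is a homogeneous Poisson point process of intensity α and 𝒳(x,·) is the uniform distribution on the annulus B_O(R) \ B_O(R−δ) of inner radius R−δ and outer radius R. Then for any arbitrarily small a, r > 0 there exist constants 0 < α, μ, δ, R < ∞ such that the intensity αμ of Φ_α^{R,δ,μ} equals a and the critical radius for percolation of its Boolean model satisfies r_c(Φ_α^{R,δ,μ}) ≤ r. -/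

import Mathlib

open MeasureTheory ENNReal Metric

noncomputable section

/-- The plane `ℝ²`. -/
abbrev E2 := EuclideanSpace ℝ (Fin 2)

/-- A subset of the plane percolates if it contains an unbounded connected subset. -/
def Percolates (S : Set E2) : Prop :=
  ∃ C : Set E2, C ⊆ S ∧ IsConnected C ∧ ¬ Bornology.IsBounded C

/-- The set of atoms (points) of a counting measure. -/
def atomsOf (μ : Measure E2) : Set E2 := {x | μ {x} ≠ 0}

/-- The Boolean model `C(Φ,r) = ⋃_{X ∈ Φ} B_r(X)` of a counting measure. -/
def BooleanModel (μ : Measure E2) (r : ℝ) : Set E2 := ⋃ x ∈ atomsOf μ, closedBall x r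

/-- The critical radius for percolation of the Boolean model,
`r_c(Φ) = inf { r : P(C(Φ,r) percolates) > 0 }`. -/
def criticalRadius {Ω : Type*} [MeasurableSpace Ω] (P : Measure Ω)
    (Φ : Ω → Measure E2) : ℝ :=
  sInf {r : ℝ | 0 < P {ω | Percolates (BooleanModel (Φ ω) r)}}

/-- The Poisson probability `e^{−t} t^n / n!`. -/
def poissonPMF (t : ℝ≥0∞) (n : ℕ) : ℝ≥0∞ :=
  ENNReal.ofReal (Real.exp (-t.toReal) * t.toReal ^ n / n.factorial)

/-- `Φ` is a Poisson point process with intensity measure `m`. -/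
def IsPoissonPP {Ω : Type*} [MeasurableSpace Ω] (P : Measure Ω)
    (Φ : Ω → Measure E2) (m : Measure E2) : Prop :=
  Measurable Φ ∧
    ∀ (k : ℕ) (B : Fin k → Set E2),
      (∀ i, MeasurableSet (B i) ∧ Bornology.IsBounded (B i)) →
      Pairwise (Function.onFun Disjoint B) →
      ∀ n : Fin k → ℕ,
        P {ω | ∀ i, Φ ω (B i) = (n i : ℝ≥0∞)} = ∏ i, poissonPMF (m (B i)) (n i)

/-- The annulus `B_O(R) ∖ B_O(R−δ)` centered at the origin. -/
def annulus (R δ : ℝ) : Set E2 := closedBall 0 R \ ball 0 (R - δ)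

/-- The uniform distribution `𝒳(0,·)` on the annulus `B_O(R) ∖ B_O(R−δ)`. -/
def annUnif (R δ : ℝ) : Measure E2 :=
  (volume (annulus R δ))⁻¹ • volume.restrict (annulus R δ)

/-- `Φ` is a Cox point process directed by the random intensity measure `Λ`:
conditionally on `Λ`, the numbers of points of `Φ` in disjoint bounded Borel
sets are independent Poisson random variables with means `Λ(B_i)`. -/
def IsCoxPP {Ω : Type*} [MeasurableSpace Ω] (P : Measure Ω)
    (Φ : Ω → Measure E2) (Λ : Ω → Measure E2) : Prop :=
  Measurable Φ ∧ Measurable Λ ∧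
    ∀ (k : ℕ) (B : Fin k → Set E2),
      (∀ i, MeasurableSet (B i) ∧ Bornology.IsBounded (B i)) →
      Pairwise (Function.onFun Disjoint B) →
      ∀ (n : Fin k → ℕ) (S : Set (Measure E2)), MeasurableSet S →
        P {ω | Λ ω ∈ S ∧ ∀ i, Φ ω (B i) = (n i : ℝ≥0∞)}
          = ∫⁻ ω in {ω | Λ ω ∈ S}, ∏ i, poissonPMF (Λ ω (B i)) (n i) ∂P

/-- Equality or nearest-neighbour adjacency in the quadrant `ℕ²`. -/
def NearestAdj (p q : ℕ × ℕ) : Prop :=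
  (p.1 = q.1 ∧ (p.2 = q.2 + 1 ∨ q.2 = p.2 + 1)) ∨ (p.2 = q.2 ∧ (p.1 = q.1 + 1 ∨ q.1 = p.1 + 1))

/-- Equality or king-move adjacency in the quadrant `ℕ²`. -/
def StarAdj (p q : ℕ × ℕ) : Prop :=
  p.1 ≤ q.1 + 1 ∧ q.1 ≤ p.1 + 1 ∧ p.2 ≤ q.2 + 1 ∧ q.2 ≤ p.2 + 1

/-- The nearest-neighbour cluster of the origin in the set of good sites. -/
def goodCluster (good : ℕ × ℕ → Prop) : Set (ℕ × ℕ) :=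
  {p | Relation.ReflTransGen (fun p q => NearestAdj p q ∧ good p ∧ good q) (0, 0) p}

lemma NearestAdj.symm {p q : ℕ × ℕ} (h : NearestAdj p q) : NearestAdj q p := by
  unfold NearestAdj at *; omega

/-- Potential of a closed `ZMod 2`-valued edge function on `ℕ²`. -/
lemma exists_potential (φ : ℕ × ℕ → ℕ × ℕ → ZMod 2)
    (hφ : ∀ x y, φ (x, y) (x + 1, y) + φ (x + 1, y) (x + 1, y + 1)
      = φ (x, y) (x, y + 1) + φ (x, y + 1) (x + 1, y + 1)) :
    ∃ f : ℕ × ℕ → ZMod 2, f (0, 0) = 0 ∧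
      (∀ x y, f (x + 1, y) = f (x, y) + φ (x, y) (x + 1, y)) ∧
      (∀ x y, f (x, y + 1) = f (x, y) + φ (x, y) (x, y + 1)) := by
  refine ⟨fun p => ∑ i ∈ Finset.range p.1, φ (i, 0) (i + 1, 0)
    + ∑ j ∈ Finset.range p.2, φ (p.1, j) (p.1, j + 1), by simp, ?_, ?_⟩
  · intro x y
    induction y with
    | zero => simp [Finset.sum_range_succ]
    | succ y ih =>
      simp only [Finset.sum_range_succ] at ih ⊢
      linear_combination ih + hφ x y
  · intro x y
    simp only [Finset.sum_range_succ]
    ring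

/-- If the good cluster of the origin in the quadrant is finite, a king-connected set of bad sites
joins the horizontal axis to the vertical axis. -/
lemma exists_bad_star_connection (good : ℕ × ℕ → Prop) (hfin : (goodCluster good).Finite) :
    ∃ k y : ℕ, ¬ good (k, 0) ∧
      Relation.ReflTransGen (fun p q => StarAdj p q ∧ ¬ good p ∧ ¬ good q) (k, 0) (0, y) := by
  classical
  by_cases h0 : good (0, 0)
  swap
  · exact ⟨0, 0, h0, .refl⟩
  set C := goodCluster good with hC
  have hC0 : (0, 0) ∈ C := Relation.ReflTransGen.refl
  have hCgood : ∀ p ∈ C, good p := by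
    intro p hp
    rcases Relation.ReflTransGen.cases_tail hp with h | ⟨q, -, h⟩
    · rw [h]; exact h0
    · exact h.2.2
  have hCadj : ∀ p ∈ C, ∀ q, NearestAdj p q → good q → q ∈ C := fun p hp q hpq hq =>
    Relation.ReflTransGen.tail hp ⟨hpq, hCgood p hp, hq⟩
  obtain ⟨N, hN⟩ : ∃ N : ℕ, ∀ p ∈ C, p.1 < N ∧ p.2 < N := by
    obtain ⟨B, hB⟩ := (hfin.image fun p => p.1 + p.2).bddAbove
    refine ⟨B + 1, fun p hp => ?_⟩
    have : p.1 + p.2 ≤ B := hB ⟨p, hp, rfl⟩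
    omega
  obtain ⟨m, hm, hmax⟩ : ∃ m, (m, 0) ∈ C ∧ ∀ k, m < k → (k, 0) ∉ C := by
    refine ⟨Nat.findGreatest (fun m => (m, 0) ∈ C) N,
      Nat.findGreatest_spec (P := fun m => (m, 0) ∈ C) (Nat.zero_le N) hC0, ?_⟩
    intro k hk hkC
    exact Nat.findGreatest_is_greatest hk (hN _ hkC).1.le hkC
  have hbad : ¬ good (m + 1, 0) := fun h =>
    hmax (m + 1) (by omega) (hCadj _ hm _ (by unfold NearestAdj; simp) h)
  set S : Set (ℕ × ℕ) := {p | Relation.ReflTransGen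
    (fun p q => StarAdj p q ∧ ¬ good p ∧ ¬ good q) (m + 1, 0) p} with hS
  have hS0 : (m + 1, 0) ∈ S := Relation.ReflTransGen.refl
  have hSbad : ∀ p ∈ S, ¬ good p := by
    intro p hp
    rcases Relation.ReflTransGen.cases_tail hp with h | ⟨q, -, h⟩
    · rw [h]; exact hbad
    · exact h.2.2
  have hSadj : ∀ p ∈ S, ∀ q, StarAdj p q → ¬ good q → q ∈ S := fun p hp q hpq hq =>
    Relation.ReflTransGen.tail hp ⟨hpq, hSbad p hp, hq⟩
  have hdisj : ∀ p ∈ C, p ∉ S := fun p hp hp' => hSbad p hp' (hCgood p hp)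
  refine ⟨m + 1, ?_⟩
  by_contra! hcol
  replace hcol : ∀ y, (0, y) ∉ S := fun y => hcol y hbad
  let φ : ℕ × ℕ → ℕ × ℕ → ZMod 2 := fun p q =>
    if (p ∈ C ∧ q ∈ S) ∨ (p ∈ S ∧ q ∈ C) then 1 else 0
  -- within a unit square, a boundary edge of `C` away from `S` excludes `S` from the square
  have hkey : ∀ p q, NearestAdj p q → p ∈ C → q ∉ C → q ∉ S →
      ∀ t, StarAdj t q → t ∉ S := by
    intro p q hpq hp hq hqS t htq ht
    exact hqS (hSadj t ht q htq fun hg => hq (hCadj p hp q hpq hg))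
  let χ : ℕ × ℕ → ZMod 2 := fun p => if p ∈ C then 1 else 0
  have two : (1 + 1 : ZMod 2) = 0 := rfl
  have hφχ : ∀ t ∈ S, ∀ p q, NearestAdj p q → StarAdj t p → StarAdj t q →
      φ p q = χ p + χ q := by
    intro t ht p q hpq hp hq
    have h1 := fun h h' h'' => hkey p q hpq h h' h'' t hq ht
    have h2 := fun h h' h'' => hkey q p hpq.symm h h' h'' t hp ht
    have d1 := hdisj p
    have d2 := hdisj q
    by_cases c1 : p ∈ C <;> by_cases c2 : q ∈ C <;> simp [φ, χ, c1, c2, d1, d2, two]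
    · by_contra h; exact h1 c1 c2 h
    · by_contra h; exact h2 c2 c1 h
  obtain ⟨f, f0, fx, fy⟩ := exists_potential φ (by
    intro x y
    by_cases hs : ∃ t ∈ S, ∃ a b : ℕ, t = (a, b) ∧ a ≤ x + 1 ∧ x ≤ a ∧ b ≤ y + 1 ∧ y ≤ b
    · obtain ⟨_, ht, a, b, rfl, h1, h2, h3, h4⟩ := hs
      have key := hφχ _ ht
      rw [key (x, y) (x + 1, y), key (x + 1, y) (x + 1, y + 1), key (x, y) (x, y + 1),
        key (x, y + 1) (x + 1, y + 1)]
      · linear_combination (χ (x + 1, y) - χ (x, y + 1)) * two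
      all_goals first | (unfold NearestAdj; simp) | (unfold StarAdj; simp only; omega)
    · push Not at hs
      have hn : ∀ a b : ℕ, a ≤ x + 1 → x ≤ a → b ≤ y + 1 → y ≤ b → (a, b) ∉ S :=
        fun a b h1 h2 h3 h4 ht => absurd h4 (not_le.2 (hs _ ht a b rfl h1 h2 h3))
      simp [φ, hn])
  have hφ0 : ∀ p q, p ∉ C → q ∉ C → φ p q = 0 := by
    intro p q hp hq; simp [φ, hp, hq]
  have hφC : ∀ p q, p ∈ C → q ∈ C → φ p q = 0 := by
    intro p q hp hq; simp [φ, hdisj p hp, hdisj q hq]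
  have hφcol : ∀ y, φ (0, y) (0, y + 1) = 0 := by
    intro y; simp [φ, hcol]
  have hcol0 : ∀ y, f (0, y) = 0 := by
    intro y
    induction y with
    | zero => exact f0
    | succ y ih => rw [fy, ih, hφcol, add_zero]
  have hout : ∀ a b, (N ≤ a ∨ N ≤ b) → (a, b) ∉ C := by
    intro a b hab h
    have := hN _ h
    simp only at this
    omega
  have hrow : ∀ x, f (x, N) = 0 := by
    intro x
    induction x with
    | zero => exact hcol0 N
    | succ x ih =>
      rw [fx, ih, hφ0 _ _ (hout _ _ (.inr le_rfl)) (hout _ _ (.inr le_rfl)), add_zero]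
  have hside : ∀ y ≤ N, f (N, y) = 0 := by
    intro y hy
    induction hy using Nat.decreasingInduction with
    | self => exact hrow N
    | of_succ y _ ih =>
      rwa [fy, hφ0 _ _ (hout _ _ (.inl le_rfl)) (hout _ _ (.inl le_rfl)), add_zero] at ih
  have hmN : m + 1 ≤ N := (hN _ hm).1
  have hbottom : f (m + 1, 0) = 0 := by
    have : ∀ k ≤ N, m + 1 ≤ k → f (k, 0) = 0 := by
      intro k hk
      induction hk using Nat.decreasingInduction with
      | self => exact fun _ => hside 0 (Nat.zero_le _)
      | of_succ k _ ih =>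
        intro hk
        have := ih (by omega)
        rwa [fx, hφ0 _ _ (hmax _ (by omega)) (hmax _ (by omega)), add_zero] at this
    exact this _ hmN le_rfl
  have hCconst : ∀ p ∈ C, f p = 0 := by
    intro p hp
    induction hp with
    | refl => exact f0
    | @tail q p hq hqp ih =>
      have hp : p ∈ C := Relation.ReflTransGen.tail hq hqp
      replace hq : q ∈ C := hq
      have h1 := hφC _ _ hp hq
      have h2 := hφC _ _ hq hp
      obtain ⟨a, b⟩ := p
      obtain ⟨c, d⟩ := q
      rcases hqp.1 with ⟨h, h' | h'⟩ | ⟨h, h' | h'⟩ <;> simp only at h h' <;> subst h <;> subst h'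
      · rw [fy, h1, add_zero] at ih; exact ih
      · rw [fy, h2, add_zero]; exact ih
      · rw [fx, h1, add_zero] at ih; exact ih
      · rw [fx, h2, add_zero]; exact ih
  have := fx m 0
  rw [hbottom, hCconst _ hm] at this
  simp [φ, hm, hS0] at this

/-- Lists of `n + 1` sites, each a king move from the next, starting at `x`. -/
def starPaths : ℕ → ℕ × ℕ → Finset (List (ℕ × ℕ))
  | 0, x => {[x]}
  | n + 1, x => (Finset.Icc (x.1 - 1) (x.1 + 1) ×ˢ Finset.Icc (x.2 - 1) (x.2 + 1)).biUnion
      fun y => (starPaths n y).image (x :: ·)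

lemma card_starPaths_le (n : ℕ) (x : ℕ × ℕ) : (starPaths n x).card ≤ 9 ^ n := by
  induction n generalizing x with
  | zero => simp [starPaths]
  | succ n ih =>
    rw [starPaths]
    refine (Finset.card_biUnion_le_card_mul _ _ (9 ^ n)
      fun y _ => Finset.card_image_le.trans (ih y)).trans ?_
    rw [pow_succ', Finset.card_product]
    gcongr
    simp only [Nat.card_Icc]
    exact Nat.mul_le_mul (by omega : _ ≤ 3) (by omega : _ ≤ 3)

lemma mem_starPaths (l : List (ℕ × ℕ)) (x : ℕ × ℕ) (h : List.IsChain StarAdj (x :: l)) :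
    x :: l ∈ starPaths l.length x := by
  induction l generalizing x with
  | nil => simp [starPaths]
  | cons y l ih =>
    rw [List.isChain_cons_cons] at h
    simp only [List.length_cons, starPaths, Finset.mem_biUnion, Finset.mem_product,
      Finset.mem_Icc, Finset.mem_image]
    refine ⟨y, ?_, _, ih y h.2, rfl⟩
    have := h.1
    unfold StarAdj at this
    omega

/-- A king-connected set of bad sites reaching the vertical axis contains a self-avoiding path of
prescribed length. -/
lemma exists_nodup_bad_path (bad : ℕ × ℕ → Prop) {k y : ℕ} (hk : bad (k, 0))
    (h : Relation.ReflTransGen (fun p q => StarAdj p q ∧ bad p ∧ bad q) (k, 0) (0, y)) :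
    ∃ l ∈ starPaths k (k, 0), l.Nodup ∧ l.length = k + 1 ∧ ∀ z ∈ l, bad z := by
  let G : SimpleGraph (ℕ × ℕ) :=
    { Adj := fun p q => p ≠ q ∧ StarAdj p q ∧ bad p ∧ bad q
      symm := ⟨fun p q h => ⟨h.1.symm, by have := h.2.1; unfold StarAdj at *; omega,
        h.2.2.2, h.2.2.1⟩⟩
      loopless := ⟨fun p h => h.1 rfl⟩ }
  have hreach : G.Reachable (k, 0) (0, y) := by
    generalize (0, y) = v at h
    induction h with
    | refl => exact SimpleGraph.Reachable.refl _
    | @tail q p _ hqp ih =>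
      by_cases hpq : q = p
      · rwa [← hpq]
      · exact ih.trans (SimpleGraph.Adj.reachable (show G.Adj q p from ⟨hpq, hqp⟩))
  obtain ⟨w, hw⟩ := hreach.exists_isPath
  have hlen : ∀ {u v : ℕ × ℕ} (w : G.Walk u v), u.1 ≤ v.1 + w.length := by
    intro u v w
    induction w with
    | nil => simp
    | cons h _ ih =>
      have := h.2.1.1
      rw [SimpleGraph.Walk.length_cons]
      omega
  have hk' : k ≤ w.length := by simpa using hlen w
  have hbad : ∀ z ∈ w.support, bad z := by
    have : ∀ {u v : ℕ × ℕ} (w : G.Walk u v), bad u → ∀ z ∈ w.support, bad z := by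
      intro u v w
      induction w with
      | nil => intro hu z hz; simp at hz; rwa [hz]
      | cons h _ ih =>
        intro hu z hz
        rw [SimpleGraph.Walk.support_cons, List.mem_cons] at hz
        rcases hz with rfl | hz
        · exact hu
        · exact ih h.2.2.2 z hz
    exact this w hk
  have hchain : List.IsChain StarAdj w.support :=
    w.isChain_adj_support.imp fun _ _ h => h.2.1
  have hsup : w.support = (k, 0) :: w.support.tail := w.cons_tail_support.symm
  refine ⟨w.support.take (k + 1), ?_, ((SimpleGraph.Walk.isPath_def _).1 hw).sublist
    (List.take_sublist _ _), ?_, fun z hz => hbad z (List.mem_of_mem_take hz)⟩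
  · have h1 := hchain.take (k + 1)
    rw [hsup, List.take_succ_cons] at h1 ⊢
    convert mem_starPaths _ _ h1
    simp [hk']
  · simp [hk']

/-- The indices within sup-distance `3` of `z`. -/
def nbhd (z : ℤ × ℤ) : Finset (ℤ × ℤ) :=
  Finset.Icc (z.1 - 3) (z.1 + 3) ×ˢ Finset.Icc (z.2 - 3) (z.2 + 3)

lemma card_nbhd (z : ℤ × ℤ) : (nbhd z).card = 49 := by
  simp only [nbhd, Finset.card_product, Int.card_Icc]
  have h : ∀ a : ℤ, (a + 3 + 1 - (a - 3)).toNat = 7 := fun a => by omega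
  rw [h, h]

lemma mem_nbhd_comm {z w : ℤ × ℤ} : z ∈ nbhd w ↔ w ∈ nbhd z := by
  simp only [nbhd, Finset.mem_product, Finset.mem_Icc]; omega

section Peierls

variable {Ω : Type*} [MeasurableSpace Ω] {P : Measure Ω}

/-- If all the events of large subfamilies of `U` are exponentially unlikely, then so is the
occurrence of a proportion `1 / d` of the events indexed by `U`. -/
lemma measure_many_le {ι : Type*} (E : ι → Ω → Prop) (U : Finset ι) (q : ℝ≥0∞) (hq : q ≤ 1)
    (d n : ℕ) (hE : ∀ W ⊆ U, P {ω | ∀ z ∈ W, E z ω} ≤ (q ^ d) ^ W.card) :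
    P {ω | ∃ W ⊆ U, n ≤ d * W.card ∧ ∀ z ∈ W, E z ω} ≤ 2 ^ U.card * q ^ n := by
  classical
  have : {ω | ∃ W ⊆ U, n ≤ d * W.card ∧ ∀ z ∈ W, E z ω} ⊆
      ⋃ W ∈ U.powerset.filter (fun W => n ≤ d * W.card), {ω | ∀ z ∈ W, E z ω} := by
    rintro ω ⟨W, hW, hn, h⟩
    simp only [Set.mem_iUnion]
    exact ⟨W, by simp [hW, hn], h⟩
  calc _ ≤ _ := measure_mono this
    _ ≤ ∑ W ∈ U.powerset.filter (fun W => n ≤ d * W.card), P {ω | ∀ z ∈ W, E z ω} :=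
        measure_biUnion_finset_le _ _
    _ ≤ ∑ W ∈ U.powerset.filter (fun W => n ≤ d * W.card), q ^ n := by
        refine Finset.sum_le_sum fun W hW => ?_
        simp only [Finset.mem_filter, Finset.mem_powerset] at hW
        refine (hE W hW.1).trans ?_
        rw [← pow_mul]
        exact pow_le_pow_right_of_le_one' hq hW.2
    _ ≤ 2 ^ U.card * q ^ n := by
        rw [Finset.sum_const, nsmul_eq_mul]
        gcongr
        exact_mod_cast (Finset.card_filter_le _ _).trans (Finset.card_powerset U).le

/-- The probability `1 / 200` entering the bound on cells without cluster centers. -/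
def epsCenter : ℝ≥0∞ := 200⁻¹

/-- The probability entering the bound on cells with an unoccupied heavy square. -/
def epsSquare : ℝ≥0∞ := (100 * 2 ^ 49)⁻¹

variable {E G : ℤ × ℤ → Ω → Prop}

/-- The probability that all the cells of a finite set are bad is exponentially small. -/
lemma measure_all_bad_le
    (hE : ∀ T : Finset (ℤ × ℤ), P {ω | ∀ z ∈ T, E z ω} ≤ (epsCenter ^ 2) ^ T.card)
    (hG : ∀ T : Finset (ℤ × ℤ), P {ω | ∀ z ∈ T, G z ω} ≤ (epsSquare ^ 98) ^ T.card)
    (T : Finset (ℤ × ℤ)) :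
    P {ω | ∀ z ∈ T, E z ω ∨ ∃ w ∈ nbhd z, G w ω} ≤ 2 * (100⁻¹) ^ T.card := by
  classical
  set U := T.biUnion nbhd with hU
  have hUcard : U.card ≤ 49 * T.card := by
    rw [mul_comm]
    exact Finset.card_biUnion_le_card_mul _ _ _ fun z _ => (card_nbhd z).le
  have hsub : {ω | ∀ z ∈ T, E z ω ∨ ∃ w ∈ nbhd z, G w ω} ⊆
      {ω | ∃ W ⊆ T, T.card ≤ 2 * W.card ∧ ∀ z ∈ W, E z ω} ∪
      {ω | ∃ W ⊆ U, T.card ≤ 98 * W.card ∧ ∀ z ∈ W, G z ω} := by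
    intro ω hω
    by_contra! hcon
    simp only [Set.mem_union, Set.mem_ofPred_eq, not_or] at hcon
    have h1 : T.card > 2 * (T.filter fun z => E z ω).card := by
      by_contra! h
      exact hcon.1 ⟨_, Finset.filter_subset _ _, h, by simp⟩
    have h2 : T.card > 98 * (U.filter fun z => G z ω).card := by
      by_contra! h
      exact hcon.2 ⟨_, Finset.filter_subset _ _, h, by simp⟩
    have h3 : T ⊆ (T.filter fun z => E z ω) ∪ (U.filter fun z => G z ω).biUnion nbhd := by
      intro z hz
      rcases hω z hz with h | ⟨w, hw, h⟩
      · simp [hz, h]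
      · refine Finset.mem_union_right _ (Finset.mem_biUnion.2 ⟨w, ?_, mem_nbhd_comm.2 hw⟩)
        exact Finset.mem_filter.2 ⟨Finset.mem_biUnion.2 ⟨z, hz, hw⟩, h⟩
    have h4 := (Finset.card_le_card h3).trans (Finset.card_union_le _ _)
    have h5 : ((U.filter fun z => G z ω).biUnion nbhd).card
        ≤ (U.filter fun z => G z ω).card * 49 :=
      Finset.card_biUnion_le_card_mul _ _ _ fun z _ => (card_nbhd z).le
    omega
  refine (measure_mono hsub).trans ((measure_union_le _ _).trans ?_)
  rw [two_mul]
  have e1 : epsCenter ≤ 1 := by simp [epsCenter]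
  have e2 : epsSquare ≤ 1 := by
    rw [epsSquare, ENNReal.inv_le_one]
    exact_mod_cast (by norm_num : 1 ≤ 100 * 2 ^ 49)
  refine add_le_add ?_ ?_
  · refine (measure_many_le E T _ e1 2 T.card fun W _ => hE W).trans ?_
    rw [← mul_pow]
    gcongr
    rw [epsCenter, show (200 : ℝ≥0∞) = 2 * 100 by norm_num,
      ENNReal.mul_inv (by simp) (by simp), ← mul_assoc, ENNReal.mul_inv_cancel (by simp) (by simp),
      one_mul]
  · refine (measure_many_le G U _ e2 98 T.card fun W _ => hG W).trans ?_
    calc _ ≤ (2 : ℝ≥0∞) ^ (49 * T.card) * epsSquare ^ T.card := by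
          gcongr
          norm_num
      _ = (2 ^ 49 * epsSquare) ^ T.card := by rw [pow_mul, ← mul_pow]
      _ ≤ _ := by
          gcongr
          rw [epsSquare, ENNReal.mul_inv (by simp) (by simp), mul_comm (100⁻¹), ← mul_assoc,
            ENNReal.mul_inv_cancel (by simp) (by simp), one_mul]

/-- Peierls' argument: with positive probability the cluster of good cells is infinite. -/
lemma measure_goodCluster_finite_lt_one
    (hE : ∀ T : Finset (ℤ × ℤ), P {ω | ∀ z ∈ T, E z ω} ≤ (epsCenter ^ 2) ^ T.card)
    (hG : ∀ T : Finset (ℤ × ℤ), P {ω | ∀ z ∈ T, G z ω} ≤ (epsSquare ^ 98) ^ T.card) :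
    P {ω | (goodCluster fun p : ℕ × ℕ =>
      ¬ (E (p.1, p.2) ω ∨ ∃ w ∈ nbhd (p.1, p.2), G w ω)).Finite} < 1 := by
  classical
  let bad : Ω → ℕ × ℕ → Prop := fun ω p => E (p.1, p.2) ω ∨ ∃ w ∈ nbhd (p.1, p.2), G w ω
  let c : ℕ × ℕ ↪ ℤ × ℤ := ⟨fun p => (p.1, p.2), fun p q h => by
    simp only [Prod.mk.injEq, Nat.cast_inj] at h; exact Prod.ext h.1 h.2⟩
  have hsub : {ω | (goodCluster fun p : ℕ × ℕ => ¬ bad ω p).Finite} ⊆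
      ⋃ k : ℕ, ⋃ l ∈ starPaths k (k, 0), {ω | l.Nodup ∧ l.length = k + 1 ∧ ∀ z ∈ l, bad ω z} := by
    intro ω hω
    obtain ⟨k, y, hk, h⟩ := exists_bad_star_connection _ hω
    simp only [not_not] at hk h
    obtain ⟨l, hl, h⟩ := exists_nodup_bad_path (bad ω) hk h
    simp only [Set.mem_iUnion]
    exact ⟨k, l, hl, h⟩
  have hpath : ∀ (k : ℕ) (l : List (ℕ × ℕ)),
      P {ω | l.Nodup ∧ l.length = k + 1 ∧ ∀ z ∈ l, bad ω z} ≤ 2 * (100⁻¹) ^ (k + 1) := by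
    intro k l
    by_cases hl : l.Nodup ∧ l.length = k + 1
    · have hcard : (l.toFinset.map c).card = k + 1 := by
        rw [Finset.card_map, List.toFinset_card_of_nodup hl.1, hl.2]
      rw [← hcard]
      refine le_trans (measure_mono ?_) (measure_all_bad_le hE hG (l.toFinset.map c))
      intro ω hω z hz
      obtain ⟨p, hp, rfl⟩ := Finset.mem_map.1 hz
      exact hω.2.2 p (List.mem_toFinset.1 hp)
    · have : {ω | l.Nodup ∧ l.length = k + 1 ∧ ∀ z ∈ l, bad ω z} = ∅ := by
        ext ω
        simp only [Set.mem_ofPred_eq, Set.mem_empty_iff_false, iff_false]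
        exact fun h => hl ⟨h.1, h.2.1⟩
      rw [this, measure_empty]
      exact zero_le
  have hterm : ∀ k : ℕ, (9 : ℝ≥0∞) ^ k * (2 * (100⁻¹) ^ (k + 1)) ≤ 4⁻¹ * (2⁻¹) ^ k := by
    intro k
    have h9 : (9 : ℝ≥0∞) * 100⁻¹ ≤ 2⁻¹ := by
      rw [← div_eq_mul_inv]
      refine ENNReal.div_le_of_le_mul ?_
      rw [mul_comm, ← div_eq_mul_inv, ENNReal.le_div_iff_mul_le (by simp) (by simp)]
      norm_num
    have h2 : (2 : ℝ≥0∞) * 100⁻¹ ≤ 4⁻¹ := by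
      rw [← div_eq_mul_inv]
      refine ENNReal.div_le_of_le_mul ?_
      rw [mul_comm, ← div_eq_mul_inv, ENNReal.le_div_iff_mul_le (by simp) (by simp)]
      norm_num
    calc _ = (2 * 100⁻¹) * (9 * (100 : ℝ≥0∞)⁻¹) ^ k := by rw [mul_pow, pow_succ]; ring
      _ ≤ _ := by gcongr
  calc P {ω | (goodCluster fun p : ℕ × ℕ => ¬ bad ω p).Finite}
      ≤ ∑' k : ℕ, P (⋃ l ∈ starPaths k (k, 0),
          {ω | l.Nodup ∧ l.length = k + 1 ∧ ∀ z ∈ l, bad ω z}) :=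
        (measure_mono hsub).trans (measure_iUnion_le _)
    _ ≤ ∑' k : ℕ, 4⁻¹ * (2⁻¹ : ℝ≥0∞) ^ k := by
        refine ENNReal.tsum_le_tsum fun k => ?_
        refine (measure_biUnion_finset_le _ _).trans ?_
        refine (Finset.sum_le_sum fun l _ => hpath k l).trans ?_
        rw [Finset.sum_const, nsmul_eq_mul]
        refine le_trans ?_ (hterm k)
        gcongr
        exact_mod_cast card_starPaths_le k (k, 0)
    _ = 4⁻¹ * 2 := by
        rw [ENNReal.tsum_mul_left, ENNReal.tsum_geometric, ENNReal.one_sub_inv_two, inv_inv]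
    _ < 1 := by
        rw [mul_comm, ← div_eq_mul_inv]
        refine ENNReal.div_lt_of_lt_mul ?_
        norm_num

end Peierls

section Cox

variable {Ω : Type*} [MeasurableSpace Ω] {P : Measure Ω} {Φ Λ : Ω → Measure E2}

lemma IsPoissonPP.isCoxPP [IsProbabilityMeasure P] {m : Measure E2} (h : IsPoissonPP P Φ m) :
    IsCoxPP P Φ fun _ => m := by
  refine ⟨h.1, measurable_const, fun k B hB hd n S _ => ?_⟩
  by_cases hm : m ∈ S
  · simpa [hm] using! h.2 k B hB hd n
  · simp [hm]

lemma tsum_poissonPMF (t : ℝ≥0∞) : ∑' n, poissonPMF t n = 1 := by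
  unfold poissonPMF
  have hs := NormedSpace.expSeries_div_hasSum_exp (t.toReal : ℝ)
  rw [← Real.exp_eq_exp_ℝ] at hs
  have hs := hs.mul_left (Real.exp (-t.toReal))
  rw [← Real.exp_add, neg_add_cancel, Real.exp_zero] at hs
  simp only [← mul_div_assoc] at hs
  rw [← ENNReal.ofReal_tsum_of_nonneg (fun n => by positivity) hs.summable, hs.tsum_eq,
    ENNReal.ofReal_one]

lemma IsCoxPP.measurable_apply (h : IsCoxPP P Φ Λ) {B : Set E2} (hB : MeasurableSet B) :
    Measurable fun ω => Φ ω B :=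
  (Measure.measurable_coe hB).comp h.1

lemma measurable_poissonPMF (n : ℕ) : Measurable fun t => poissonPMF t n := by
  unfold poissonPMF
  fun_prop

/-- A Cox process takes integer values almost surely on a bounded Borel set. -/
lemma IsCoxPP.ae_natCast [IsProbabilityMeasure P] (h : IsCoxPP P Φ Λ) {B : Set E2}
    (hB : MeasurableSet B) (hb : Bornology.IsBounded B) : ∀ᵐ ω ∂P, ∃ n : ℕ, Φ ω B = n := by
  have hmeas : ∀ n : ℕ, MeasurableSet {ω | Φ ω B = n} := fun n =>
    h.measurable_apply hB (measurableSet_singleton _)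
  have hset : {ω | ∃ n : ℕ, Φ ω B = n} = ⋃ n : ℕ, {ω | Φ ω B = n} := by ext; simp
  have hP : P {ω | ∃ n : ℕ, Φ ω B = n} = 1 := by
    rw [hset, measure_iUnion _ hmeas]
    · have : ∀ n : ℕ, P {ω | Φ ω B = n} = ∫⁻ ω, poissonPMF (Λ ω B) n ∂P := by
        intro n
        have := h.2.2 1 (fun _ => B) (fun _ => ⟨hB, hb⟩)
          (fun i j hij => absurd (Subsingleton.elim i j) hij) (fun _ => n) Set.univ .univ
        simpa using this
      simp_rw [this]
      rw [← lintegral_tsum]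
      · simp [tsum_poissonPMF]
      · exact fun n => ((measurable_poissonPMF n).comp
          ((Measure.measurable_coe hB).comp h.2.1)).aemeasurable
    · intro i j hij
      refine Set.disjoint_left.2 fun ω h1 h2 => hij ?_
      have : (i : ℝ≥0∞) = j := Eq.trans (Eq.symm h1) h2
      exact_mod_cast this
  exact (prob_compl_eq_zero_iff (hset ▸ MeasurableSet.iUnion hmeas)).2 hP

/-- Joint void probabilities of a Cox process on disjoint sets heavily charged by the driving
measure. -/
lemma IsCoxPP.void_prob_le [IsProbabilityMeasure P] (h : IsCoxPP P Φ Λ) {ι : Type*}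
    (T : Finset ι) (B : ι → Set E2) (hB : ∀ i, MeasurableSet (B i))
    (hb : ∀ i, Bornology.IsBounded (B i))
    (hd : ∀ i ∈ T, ∀ j ∈ T, i ≠ j → Disjoint (B i) (B j)) (l : ℝ) :
    P {ω | ∀ i ∈ T, ENNReal.ofReal l ≤ Λ ω (B i) ∧ Λ ω (B i) < ∞ ∧ Φ ω (B i) = 0}
      ≤ ENNReal.ofReal (Real.exp (-l)) ^ T.card := by
  let e := T.equivFin.symm
  let S : Set (Measure E2) := {m | ∀ i ∈ T, ENNReal.ofReal l ≤ m (B i) ∧ m (B i) < ∞}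
  have hS : MeasurableSet S := by
    have : S = ⋂ i ∈ T, {m | ENNReal.ofReal l ≤ m (B i)} ∩ {m | m (B i) < ∞} := by
      ext m; simp [S]
    rw [this]
    exact Finset.measurableSet_biInter _ fun i _ =>
      (measurableSet_le measurable_const (Measure.measurable_coe (hB i))).inter
        (measurableSet_lt (Measure.measurable_coe (hB i)) measurable_const)
  have hcox := h.2.2 T.card (fun j => B (e j)) (fun j => ⟨hB _, hb _⟩)
    (fun i j hij => hd _ (e i).2 _ (e j).2 fun heq =>
      hij (e.injective (Subtype.ext heq))) (fun _ => 0) S hS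
  calc _ ≤ P {ω | Λ ω ∈ S ∧ ∀ j, Φ ω (B (e j)) = ((0 : ℕ) : ℝ≥0∞)} := by
        refine measure_mono fun ω hω => ⟨fun i hi => ⟨(hω i hi).1, (hω i hi).2.1⟩, fun j => ?_⟩
        rw [(hω _ (e j).2).2.2, Nat.cast_zero]
    _ = ∫⁻ ω in {ω | Λ ω ∈ S}, ∏ j, poissonPMF (Λ ω (B (e j))) 0 ∂P := hcox
    _ ≤ ∫⁻ ω in {ω | Λ ω ∈ S}, ENNReal.ofReal (Real.exp (-l)) ^ T.card ∂P := by
        refine setLIntegral_mono' (h.2.1 hS) fun ω hω => ?_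
        refine (Finset.prod_le_pow_card _ _ (ENNReal.ofReal (Real.exp (-l)))
          fun j _ => ?_).trans (by simp)
        have := hω _ (e j).2
        unfold poissonPMF
        refine ENNReal.ofReal_le_ofReal ?_
        simp only [pow_zero, mul_one, Nat.factorial_zero, Nat.cast_one, div_one]
        exact Real.exp_le_exp.2 (neg_le_neg ((ENNReal.ofReal_le_iff_le_toReal this.2.ne).1 this.1))
    _ ≤ ENNReal.ofReal (Real.exp (-l)) ^ T.card := by
        rw [setLIntegral_const]
        exact mul_le_of_le_one_right zero_le prob_le_one

/-- A locally integer-valued measure charging `u` has an atom in `u`. -/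
lemma exists_atom_of_natCast {ν : Measure E2} {u : Set E2}
    (hfin : ν u < ∞) (h0 : ν u ≠ 0)
    (hν : ∀ b ∈ TopologicalSpace.countableBasis E2, ∃ n : ℕ, ν (b ∩ u) = n) :
    ∃ x ∈ u, 1 ≤ ν {x} := by
  by_contra! hcon
  have : IsFiniteMeasure (ν.restrict u) := ⟨by simpa using hfin⟩
  have hB := TopologicalSpace.isBasis_countableBasis E2
  have hx : ∀ x ∈ u, ∃ b ∈ TopologicalSpace.countableBasis E2, x ∈ b ∧ ν (b ∩ u) = 0 := by
    intro x hx
    have h1 : ν.restrict u {x} < 1 := (Measure.restrict_apply_le _ _).trans_lt (hcon x hx)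
    obtain ⟨O, hO, hOo, hlt⟩ := Set.exists_isOpen_lt_of_lt _ _ h1
    obtain ⟨b, hb, hxb, hbO⟩ := hB.exists_subset_of_mem_open (hO rfl) hOo
    refine ⟨b, hb, hxb, ?_⟩
    obtain ⟨n, hn⟩ := hν b hb
    have : ν (b ∩ u) < 1 := by
      rw [← Measure.restrict_apply (hB.isOpen hb).measurableSet]
      exact (measure_mono hbO).trans_lt hlt
    rw [hn] at this ⊢
    have : n < 1 := by exact_mod_cast this
    simp [Nat.lt_one_iff.1 this]
  refine h0 (measure_mono_null (t := ⋃ b ∈ {b ∈ TopologicalSpace.countableBasis E2 |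
    ν (b ∩ u) = 0}, b ∩ u) ?_ ?_)
  · intro x hxu
    obtain ⟨b, hb, hxb, h⟩ := hx x hxu
    exact Set.mem_biUnion (x := b) ⟨hb, h⟩ ⟨hxb, hxu⟩
  · exact (measure_biUnion_null_iff ((TopologicalSpace.countable_countableBasis E2).mono
      (Set.sep_subset _ _))).2 fun b hb => hb.2

/-- Almost surely, a Cox process has an atom in each charged set of a countable family. -/
lemma IsCoxPP.ae_exists_atom [IsProbabilityMeasure P] (h : IsCoxPP P Φ Λ) {ι : Type*}
    [Countable ι] (u : ι → Set E2) (hu : ∀ i, MeasurableSet (u i))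
    (hb : ∀ i, Bornology.IsBounded (u i)) :
    ∀ᵐ ω ∂P, ∀ i, Φ ω (u i) ≠ 0 → ∃ x ∈ u i, 1 ≤ Φ ω {x} := by
  rw [ae_all_iff]
  intro i
  have h1 : ∀ᵐ ω ∂P, ∀ b ∈ TopologicalSpace.countableBasis E2, ∃ n : ℕ, Φ ω (b ∩ u i) = n :=
    (ae_ball_iff (TopologicalSpace.countable_countableBasis E2)).2 fun b hbas =>
      h.ae_natCast (((TopologicalSpace.isBasis_countableBasis E2).isOpen hbas).measurableSet.inter
        (hu i)) ((hb i).subset Set.inter_subset_right)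
  filter_upwards [h1, h.ae_natCast (hu i) (hb i)] with ω h1 ⟨n, hn⟩ h0
  exact exists_atom_of_natCast (by simp [hn]) h0 h1

end Cox

/-- The index of the half-open grid square of side `h` containing `x`. -/
def gridIndex (h : ℝ) (x : E2) : ℤ × ℤ := (⌊x 0 / h⌋, ⌊x 1 / h⌋)

/-- The half-open grid square of side `h` with index `z`. -/
def cell (h : ℝ) (z : ℤ × ℤ) : Set E2 := {x | gridIndex h x = z}

lemma measurableSet_cell (h : ℝ) (z : ℤ × ℤ) : MeasurableSet (cell h z) := by
  have : Measurable (gridIndex h) := by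
    unfold gridIndex
    refine Measurable.prodMk ?_ ?_ <;> exact Int.measurable_floor.comp (by fun_prop)
  exact this (measurableSet_singleton z)

lemma disjoint_cell {h : ℝ} {z w : ℤ × ℤ} (hzw : z ≠ w) : Disjoint (cell h z) (cell h w) :=
  Set.disjoint_left.2 fun _ h1 h2 => hzw (Eq.trans (Eq.symm h1) h2)

lemma mem_cell_iff {h : ℝ} (hh : 0 < h) {z : ℤ × ℤ} {x : E2} :
    x ∈ cell h z ↔ (z.1 * h ≤ x 0 ∧ x 0 < (z.1 + 1) * h) ∧
      (z.2 * h ≤ x 1 ∧ x 1 < (z.2 + 1) * h) := by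
  simp only [cell, gridIndex, Set.mem_ofPred_eq, Prod.ext_iff, Int.floor_eq_iff, le_div_iff₀ hh,
    div_lt_iff₀ hh]

lemma dist_le_of_abs_le {x y : E2} {a b c : ℝ} (h0 : |x 0 - y 0| ≤ a) (h1 : |x 1 - y 1| ≤ b)
    (hc : 0 ≤ c) (habc : a ^ 2 + b ^ 2 ≤ c ^ 2) : dist x y ≤ c := by
  rw [EuclideanSpace.dist_eq, Fin.sum_univ_two, Real.dist_eq, Real.dist_eq]
  refine Real.sqrt_le_iff.2 ⟨hc, le_trans ?_ habc⟩
  gcongr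

lemma abs_coord_le_dist (x y : E2) (i : Fin 2) : |x i - y i| ≤ dist x y := by
  rw [← Real.dist_eq, EuclideanSpace.dist_eq]
  refine Real.le_sqrt_of_sq_le ?_
  exact Finset.single_le_sum (f := fun i => dist (x i) (y i) ^ 2) (fun _ _ => by positivity)
    (Finset.mem_univ i)

lemma isBounded_cell {h : ℝ} (hh : 0 < h) (z : ℤ × ℤ) : Bornology.IsBounded (cell h z) := by
  refine Metric.isBounded_iff.2 ⟨2 * h, fun x hx y hy => ?_⟩
  rw [mem_cell_iff hh] at hx hy
  refine dist_le_of_abs_le (a := h) (b := h) ?_ ?_ (by positivity) (by nlinarith) <;>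
    rw [abs_le] <;> constructor <;> linarith [hx.1.1, hx.1.2, hx.2.1, hx.2.2, hy.1.1, hy.1.2,
      hy.2.1, hy.2.2]

lemma volume_cell {h : ℝ} (hh : 0 < h) (z : ℤ × ℤ) :
    volume (cell h z) = ENNReal.ofReal (h ^ 2) := by
  have : cell h z = (MeasurableEquiv.toLp 2 (Fin 2 → ℝ)).symm ⁻¹'
      (Set.univ.pi fun i => Set.Ico (![z.1 * h, z.2 * h] i) (![(z.1 + 1) * h, (z.2 + 1) * h] i)) := by
    ext x
    rw [mem_cell_iff hh]
    simp [Set.mem_pi, Fin.forall_fin_two]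
  rw [this, (EuclideanSpace.volume_preserving_symm_measurableEquiv_toLp (Fin 2)).measure_preimage
    (MeasurableSet.univ_pi fun _ => measurableSet_Ico).nullMeasurableSet, Real.volume_pi_Ico,
    Fin.prod_univ_two, ← ENNReal.ofReal_mul (by simp; linarith)]
  congr 1
  simp
  ring

lemma volume_annulus_ne_top (R δ : ℝ) : volume (annulus R δ) ≠ ∞ :=
  ((measure_mono Set.sdiff_subset).trans_lt measure_closedBall_lt_top).ne

lemma measurableSet_annulus (R δ : ℝ) : MeasurableSet (annulus R δ) :=
  measurableSet_closedBall.diff measurableSet_ball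

lemma annUnif_apply {R δ : ℝ} (B : Set E2) :
    annUnif R δ B = (volume (annulus R δ))⁻¹ * volume (B ∩ annulus R δ) := by
  rw [annUnif, Measure.smul_apply, smul_eq_mul,
    Measure.restrict_apply' (measurableSet_annulus R δ)]

lemma annUnif_le_one {R δ : ℝ} (B : Set E2) : annUnif R δ B ≤ 1 := by
  rw [annUnif_apply]
  refine (mul_le_mul_right (measure_mono Set.inter_subset_right) _).trans ?_
  exact ENNReal.inv_mul_le_one _

lemma volume_annulus_inter_closedBall (R δ η : ℝ) {q q' : E2} (h : ‖q‖ = ‖q'‖) :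
    volume (closedBall q η ∩ annulus R δ) = volume (closedBall q' η ∩ annulus R δ) := by
  set g := (ℝ ∙ (q - q'))ᗮ.reflection with hg
  have hgq : g q = q' := Submodule.reflection_sub h
  have hpre : g ⁻¹' (closedBall q' η ∩ annulus R δ) = closedBall q η ∩ annulus R δ := by
    ext y
    simp only [annulus, Set.mem_preimage, Set.mem_inter_iff, Set.mem_sdiff, mem_closedBall,
      mem_ball, dist_zero_right, g.norm_map, ← hgq, g.dist_map]
  rw [← hpre]
  exact g.measurePreserving.measure_preimage
    (measurableSet_closedBall.inter (measurableSet_annulus R δ)).nullMeasurableSet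

/-- The point of the circle of radius `R` about the origin at angle `θ`. -/
def circlePoint (R θ : ℝ) : E2 := !₂[R * Real.cos θ, R * Real.sin θ]

lemma norm_circlePoint {R : ℝ} (hR : 0 ≤ R) (θ : ℝ) : ‖circlePoint R θ‖ = R := by
  rw [EuclideanSpace.norm_eq, Fin.sum_univ_two]
  simp only [circlePoint, PiLp.toLp_apply, Matrix.cons_val_zero, Matrix.cons_val_one,
    Real.norm_eq_abs, sq_abs]
  rw [mul_pow, mul_pow, ← mul_add, Real.cos_sq_add_sin_sq, mul_one, Real.sqrt_sq hR]

lemma volume_annulus_ne_zero {R δ : ℝ} (hδ : 0 < δ) (hδR : δ ≤ R) :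
    volume (annulus R δ) ≠ 0 := by
  set p := circlePoint (R - δ / 2) 0
  have hpn : ‖p‖ = R - δ / 2 := norm_circlePoint (by linarith) 0
  have hsub : ball p (δ / 2) ⊆ annulus R δ := by
    intro y hy
    rw [mem_ball, dist_eq_norm] at hy
    have h1 := abs_le.1 (abs_norm_sub_norm_le y p)
    simp only [annulus, Set.mem_sdiff, mem_closedBall, mem_ball, dist_zero_right, not_lt]
    constructor <;> linarith [h1.1, h1.2]
  exact ((measure_ball_pos volume p (by positivity)).trans_le (measure_mono hsub)).ne'

lemma exists_eq_circlePoint (y : E2) :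
    ∃ θ, -Real.pi < θ ∧ θ ≤ Real.pi ∧ y = circlePoint ‖y‖ θ := by
  set z : ℂ := ⟨y 0, y 1⟩ with hz
  have hn : ‖z‖ = ‖y‖ := by
    rw [EuclideanSpace.norm_eq, Fin.sum_univ_two, Complex.norm_eq_sqrt_sq_add_sq]
    simp [hz]
  refine ⟨z.arg, Complex.neg_pi_lt_arg z, Complex.arg_le_pi z, ?_⟩
  ext i
  fin_cases i
  · simp [circlePoint, ← hn, Complex.norm_mul_cos_arg, hz]
  · simp [circlePoint, ← hn, Complex.norm_mul_sin_arg, hz]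

lemma dist_circlePoint_radius (R S θ : ℝ) :
    dist (circlePoint R θ) (circlePoint S θ) ≤ |R - S| := by
  refine dist_le_of_abs_le (a := |R - S| * |Real.cos θ|) (b := |R - S| * |Real.sin θ|) ?_ ?_
    (abs_nonneg _) ?_
  · simp [circlePoint, ← sub_mul, abs_mul]
  · simp [circlePoint, ← sub_mul, abs_mul]
  · rw [mul_pow, mul_pow, ← mul_add, sq_abs (Real.cos θ), sq_abs (Real.sin θ),
      Real.cos_sq_add_sin_sq, mul_one]

lemma dist_circlePoint_angle {R : ℝ} (hR : 0 ≤ R) (θ ψ : ℝ) :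
    dist (circlePoint R θ) (circlePoint R ψ) ≤ 3 / 2 * (R * |θ - ψ|) := by
  refine dist_le_of_abs_le (a := R * |θ - ψ|) (b := R * |θ - ψ|) ?_ ?_ (by positivity) ?_
  · rw [show circlePoint R θ 0 - circlePoint R ψ 0 = R * (Real.cos θ - Real.cos ψ) by
      simp [circlePoint, mul_sub], abs_mul, abs_of_nonneg hR]
    exact mul_le_mul_of_nonneg_left (Real.abs_cos_sub_cos_le _ _) hR
  · rw [show circlePoint R θ 1 - circlePoint R ψ 1 = R * (Real.sin θ - Real.sin ψ) by
      simp [circlePoint, mul_sub], abs_mul, abs_of_nonneg hR]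
    exact mul_le_mul_of_nonneg_left (Real.abs_sin_sub_sin_le _ _) hR
  · nlinarith [sq_nonneg (R * |θ - ψ|)]

/-- The annulus is covered by linearly many balls of radius `η` centered on the outer circle. -/
lemma annulus_subset_iUnion {η : ℝ} (hη : 0 < η) {L : ℕ} (hL : 1 ≤ L) :
    annulus (2 * L * η) (η / 2) ⊆ ⋃ k ∈ Finset.range (40 * L + 1),
      closedBall (circlePoint (2 * L * η) (-Real.pi + 2 * Real.pi / (40 * L) * k)) η := by
  intro y hy
  have hL' : (1 : ℝ) ≤ L := by exact_mod_cast hL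
  simp only [annulus, Set.mem_sdiff, mem_closedBall, mem_ball, dist_zero_right, not_lt] at hy
  obtain ⟨θ, h1, h2, hyθ⟩ := exists_eq_circlePoint y
  set t : ℝ := 2 * Real.pi / (40 * L) with ht
  have hpi := Real.pi_pos
  have ht0 : 0 < t := by positivity
  have hθ0 : 0 ≤ (θ + Real.pi) / t := div_nonneg (by linarith) ht0.le
  set k := ⌊(θ + Real.pi) / t⌋₊ with hk
  have hk1 : k * t ≤ θ + Real.pi := (le_div_iff₀ ht0).1 (Nat.floor_le hθ0)
  have hk2 : θ + Real.pi < (k + 1) * t := (div_lt_iff₀ ht0).1 (Nat.lt_floor_add_one _)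
  simp only [Set.mem_iUnion, Finset.mem_range]
  refine ⟨k, ?_, ?_⟩
  · have : (k : ℝ) * t ≤ (40 * L : ℕ) * t := by
      have h40 : ((40 * L : ℕ) : ℝ) * t = 2 * Real.pi := by
        rw [ht]; push_cast; field_simp
      linarith
    have := le_of_mul_le_mul_right this ht0
    exact Nat.lt_succ_of_le (by exact_mod_cast this)
  · have hR : 0 ≤ 2 * L * η := by positivity
    have hrad : dist y (circlePoint (2 * L * η) θ) ≤ η / 2 := by
      conv_lhs => rw [hyθ]
      refine (dist_circlePoint_radius _ _ _).trans (abs_le.2 ⟨?_, ?_⟩) <;> linarith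
    have hang := dist_circlePoint_angle hR θ (-Real.pi + t * k)
    have habs : |θ - (-Real.pi + t * k)| ≤ t := abs_le.2 ⟨by linarith, by linarith⟩
    have hRt : 2 * L * η * t = Real.pi * η / 10 := by
      rw [ht]; field_simp; ring
    have : 2 * L * η * |θ - (-Real.pi + t * k)| ≤ Real.pi * η / 10 := by
      rw [← hRt]; gcongr
    have hpi2 := Real.pi_lt_d2
    rw [mem_closedBall]
    refine (dist_triangle _ (circlePoint (2 * L * η) θ) _).trans ?_
    nlinarith

lemma annUnif_closedBall_ge {η : ℝ} (hη : 0 < η) {L : ℕ} (hL : 1 ≤ L) {q : E2}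
    (hq : ‖q‖ = 2 * L * η) :
    ((41 * L : ℕ) : ℝ≥0∞)⁻¹ ≤ annUnif (2 * L * η) (η / 2) (closedBall q η) := by
  have hL' : (1 : ℝ) ≤ L := by exact_mod_cast hL
  have hR : 0 ≤ 2 * L * η := by positivity
  set A := annulus (2 * L * η) (η / 2) with hA
  have hA0 : volume A ≠ 0 := volume_annulus_ne_zero (by positivity) (by nlinarith)
  have hAt : volume A ≠ ∞ := volume_annulus_ne_top _ _
  have hcov : volume A ≤ (41 * L : ℕ) * volume (closedBall q η ∩ A) := by
    calc volume A ≤ volume (⋃ k ∈ Finset.range (40 * L + 1), closedBall (circlePoint (2 * L * η)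
            (-Real.pi + 2 * Real.pi / (40 * L) * k)) η ∩ A) := by
          refine measure_mono fun y hy => ?_
          have := annulus_subset_iUnion hη hL hy
          simp only [Set.mem_iUnion, Set.mem_inter_iff] at this ⊢
          obtain ⟨k, hk, h⟩ := this
          exact ⟨k, hk, h, hy⟩
      _ ≤ ∑ k ∈ Finset.range (40 * L + 1), volume (closedBall q η ∩ A) := by
          refine (measure_biUnion_finset_le _ _).trans (Finset.sum_le_sum fun k _ => ?_)
          exact (volume_annulus_inter_closedBall _ _ _
            ((norm_circlePoint hR _).trans hq.symm)).le
      _ ≤ _ := by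
          rw [Finset.sum_const, Finset.card_range, nsmul_eq_mul]
          gcongr
          omega
  rw [annUnif_apply, ← hA, ← ENNReal.div_eq_inv_mul, ENNReal.le_div_iff_mul_le (.inl hA0)
    (.inl hAt), ← ENNReal.div_eq_inv_mul]
  exact ENNReal.div_le_of_le_mul' hcov

/-- Near each point of the outer circle there is a grid square which carries a fair share of the
uniform distribution on the annulus. -/
lemma exists_heavy_cell {η : ℝ} (hη : 0 < η) {L : ℕ} (hL : 1 ≤ L) {x p : E2}
    (hp : p ∈ sphere x (2 * L * η)) :
    ∃ i : ℤ × ℤ, |i.1 - (gridIndex η p).1| ≤ 1 ∧ |i.2 - (gridIndex η p).2| ≤ 1 ∧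
      ((9 * (41 * L) : ℕ) : ℝ≥0∞)⁻¹ ≤
        (annUnif (2 * L * η) (η / 2)).map (fun z => x + z) (cell η i) := by
  set j := gridIndex η p with hj
  set ν := (annUnif (2 * L * η) (η / 2)).map (fun z => x + z) with hν
  set I : Finset (ℤ × ℤ) := Finset.Icc (j.1 - 1) (j.1 + 1) ×ˢ Finset.Icc (j.2 - 1) (j.2 + 1)
  have hIcard : I.card = 9 := by
    simp only [I, Finset.card_product, Int.card_Icc]
    have h : ∀ a : ℤ, (a + 1 + 1 - (a - 1)).toNat = 3 := fun a => by omega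
    rw [h, h]
  have hball : ((41 * L : ℕ) : ℝ≥0∞)⁻¹ ≤ ν (closedBall p η) := by
    rw [hν, Measure.map_apply (measurable_const_add x) measurableSet_closedBall]
    have : (fun z => x + z) ⁻¹' closedBall p η = closedBall (p - x) η := by
      ext z
      simp only [Set.mem_preimage, mem_closedBall, dist_eq_norm]
      rw [show x + z - p = z - (p - x) by abel]
    rw [this]
    exact annUnif_closedBall_ge hη hL (by rwa [mem_sphere, dist_eq_norm] at hp)
  have hpj : p ∈ cell η j := rfl
  rw [mem_cell_iff hη] at hpj
  have hcov : closedBall p η ⊆ ⋃ i ∈ I, cell η i := by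
    intro y hy
    rw [mem_closedBall] at hy
    have h0 := abs_le.1 ((abs_coord_le_dist y p 0).trans hy)
    have h1 := abs_le.1 ((abs_coord_le_dist y p 1).trans hy)
    simp only [Set.mem_iUnion]
    refine ⟨gridIndex η y, ?_, rfl⟩
    have hyi : y ∈ cell η (gridIndex η y) := rfl
    rw [mem_cell_iff hη] at hyi
    generalize gridIndex η y = i at hyi
    have key : ∀ {a b : ℤ}, (a : ℝ) * η < (b + 2) * η → a ≤ b + 1 := by
      intro a b h
      have := lt_of_mul_lt_mul_right h hη.le
      have : a < b + 2 := by exact_mod_cast this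
      omega
    have e1 : i.1 ≤ j.1 + 1 := key (by linarith [hyi.1.1, hpj.1.2])
    have e2 : j.1 ≤ i.1 + 1 := key (by linarith [hyi.1.2, hpj.1.1])
    have e3 : i.2 ≤ j.2 + 1 := key (by linarith [hyi.2.1, hpj.2.2])
    have e4 : j.2 ≤ i.2 + 1 := key (by linarith [hyi.2.2, hpj.2.1])
    simp only [I, Finset.mem_product, Finset.mem_Icc]
    omega
  obtain ⟨i, hi, hmax⟩ := Finset.exists_max_image I (fun i => ν (cell η i))
    (Finset.card_pos.1 (by omega))
  refine ⟨i, ?_, ?_, ?_⟩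
  · simp only [I, Finset.mem_product, Finset.mem_Icc] at hi
    rw [abs_le]; omega
  · simp only [I, Finset.mem_product, Finset.mem_Icc] at hi
    rw [abs_le]; omega
  · have hsum : ((41 * L : ℕ) : ℝ≥0∞)⁻¹ ≤ 9 * ν (cell η i) := by
      refine hball.trans ((measure_mono hcov).trans ((measure_biUnion_finset_le _ _).trans ?_))
      refine (Finset.sum_le_card_nsmul _ _ _ hmax).trans ?_
      rw [hIcard, nsmul_eq_mul]
      norm_num
    rw [Nat.cast_mul, ENNReal.mul_inv (by simp) (by simp), ← ENNReal.div_eq_inv_mul]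
    exact ENNReal.div_le_of_le_mul' (by exact_mod_cast hsum)

lemma sphere_inter_nonempty {x y : E2} {R : ℝ} (hR : 0 ≤ R) (h : dist x y ≤ 2 * R) :
    (sphere x R ∩ sphere y R).Nonempty := by
  have hrank : 1 < Module.rank ℝ E2 := by
    rw [rank_eq_card_basis (EuclideanSpace.basisFun (Fin 2) ℝ).toBasis]; norm_num
  have hconn := (isConnected_sphere hrank x hR).isPreconnected
  have hcont : ContinuousOn (fun p : E2 => dist p y) (sphere x R) := by fun_prop
  rcases eq_or_ne x y with rfl | hxy
  · obtain ⟨p, hp⟩ := (isConnected_sphere hrank x hR).nonempty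
    exact ⟨p, hp, hp⟩
  · have hd : 0 < dist x y := dist_pos.2 hxy
    have hn : ‖y - x‖ = dist x y := by rw [dist_eq_norm, norm_sub_rev]
    have hmem : ∀ ε : ℝ, |ε| = 1 → x + (ε * (R / dist x y)) • (y - x) ∈ sphere x R := by
      intro ε hε
      rw [mem_sphere, dist_eq_norm, add_sub_cancel_left, norm_smul, hn, Real.norm_eq_abs, abs_mul,
        hε, one_mul, abs_of_nonneg (by positivity)]
      field_simp
    have hdist : ∀ ε : ℝ, dist (x + (ε * (R / dist x y)) • (y - x)) y = |ε * R - dist x y| := by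
      intro ε
      rw [dist_eq_norm, show x + (ε * (R / dist x y)) • (y - x) - y
        = (ε * (R / dist x y) - 1) • (y - x) by rw [sub_smul, one_smul]; abel, norm_smul, hn,
        Real.norm_eq_abs]
      nth_rw 2 [← abs_of_pos hd]
      rw [← abs_mul]
      congr 1
      field_simp
    obtain ⟨p, hp, hpy⟩ := hconn.intermediate_value (hmem 1 (by simp)) (hmem (-1) (by simp)) hcont
      (show R ∈ Set.Icc _ _ by
        simp only [hdist, Set.mem_Icc]
        constructor
        · rw [abs_le]; constructor <;> linarith
        · rw [abs_of_nonpos (by linarith)]; linarith)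
    exact ⟨p, hp, hpy⟩

/-- The large cell `w`, made of `L × L` squares of side `η`, contains a square charged by at least
`ℓ` by the driving measure `m` but empty for the point process `φ`. -/
def HasEmptyHeavySquare (η : ℝ) (L : ℕ) (ℓ : ℝ≥0∞) (m φ : Measure E2) (w : ℤ × ℤ) : Prop :=
  ∃ a b : Fin L, ℓ ≤ m (cell η (w.1 * L + (a : ℕ), w.2 * L + (b : ℕ))) ∧
    m (cell η (w.1 * L + (a : ℕ), w.2 * L + (b : ℕ))) < ∞ ∧
    φ (cell η (w.1 * L + (a : ℕ), w.2 * L + (b : ℕ))) = 0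

section Deterministic

variable {η : ℝ} {L : ℕ} {ℓ : ℝ≥0∞} {c m φ : Measure E2}

lemma exists_fin_eq_of_pos (hL : 0 < L) (i : ℤ) : ∃ a : Fin L, i = i / L * L + (a : ℕ) := by
  have hL' : (0 : ℤ) < L := by exact_mod_cast hL
  have h1 := Int.emod_nonneg i hL'.ne'
  have h2 := Int.emod_lt_of_pos i hL'
  refine ⟨⟨(i % L).toNat, by omega⟩, ?_⟩
  simp only [Int.toNat_of_nonneg h1]
  have := Int.mul_ediv_add_emod i L
  linarith [mul_comm (L : ℤ) (i / L)]

/-- The index of a small square near the circle about `x` belongs to a cell near the cell of `x`. -/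
lemma abs_ediv_sub_le (hη : 0 < η) (hL : 2 ≤ L) {i j z : ℤ} {u v : ℝ} (hi : |i - j| ≤ 1)
    (hj : j * η ≤ u ∧ u < (j + 1) * η) (hz : z * (L * η) ≤ v ∧ v < (z + 1) * (L * η))
    (huv : |u - v| ≤ 2 * L * η) : z - 3 ≤ i / L ∧ i / L ≤ z + 3 := by
  have hL' : (0 : ℤ) < L := by omega
  rw [abs_le] at hi huv
  have h1 : (j : ℝ) * η < ((z + 3) * L : ℤ) * η := by push_cast; linarith
  have h2 : ((z - 2) * L - 1 : ℤ) * η < (j : ℝ) * η := by push_cast; linarith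
  have h1 := lt_of_mul_lt_mul_right h1 hη.le
  have h2 := lt_of_mul_lt_mul_right h2 hη.le
  have h1 : j < (z + 3) * L := by exact_mod_cast h1
  have h2 : (z - 2) * L - 1 < j := by exact_mod_cast h2
  constructor
  · rw [Int.le_ediv_iff_mul_le hL']
    nlinarith
  · have : i / L < z + 4 := by
      rw [Int.ediv_lt_iff_lt_mul hL']
      nlinarith
    omega

/-- If no cell near `x` has an empty heavy square, the circle about `x` is covered. -/
lemma sphere_subset_booleanModel (hη : 0 < η) (hL : 2 ≤ L) {x : E2} {z : ℤ × ℤ}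
    (hx : x ∈ cell (L * η) z)
    (hheavy : ∀ i, ((9 * (41 * L) : ℕ) : ℝ≥0∞)⁻¹ ≤
        (annUnif (2 * L * η) (η / 2)).map (fun z => x + z) (cell η i) → ℓ ≤ m (cell η i))
    (hfin : ∀ i, m (cell η i) < ∞)
    (hφ : ∀ i, φ (cell η i) ≠ 0 → ∃ y ∈ cell η i, 1 ≤ φ {y})
    (hz : ∀ w ∈ nbhd z, ¬ HasEmptyHeavySquare η L ℓ m φ w) :
    sphere x (2 * L * η) ⊆ BooleanModel φ (3 * η) := by
  intro p hp
  obtain ⟨i, hi1, hi2, hi⟩ := exists_heavy_cell hη (by omega) hp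
  have hpj : p ∈ cell η (gridIndex η p) := rfl
  generalize gridIndex η p = j at hi1 hi2 hpj
  rw [mem_cell_iff hη] at hpj
  rw [mem_cell_iff (by positivity)] at hx
  have hpx := (mem_sphere.1 hp).le
  have hw : (i.1 / (L : ℤ), i.2 / (L : ℤ)) ∈ nbhd z := by
    have h1 := abs_ediv_sub_le hη hL hi1 hpj.1 hx.1 ((abs_coord_le_dist p x 0).trans hpx)
    have h2 := abs_ediv_sub_le hη hL hi2 hpj.2 hx.2 ((abs_coord_le_dist p x 1).trans hpx)
    simp only [nbhd, Finset.mem_product, Finset.mem_Icc]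
    exact ⟨h1, h2⟩
  have hne : φ (cell η i) ≠ 0 := by
    intro h0
    obtain ⟨a, ha⟩ := exists_fin_eq_of_pos (L := L) (by omega) i.1
    obtain ⟨b, hb⟩ := exists_fin_eq_of_pos (L := L) (by omega) i.2
    refine hz _ hw ⟨a, b, ?_⟩
    simp only
    rw [← ha, ← hb]
    exact ⟨hheavy i hi, hfin i, h0⟩
  obtain ⟨y, hy, hy1⟩ := hφ i hne
  rw [mem_cell_iff hη] at hy
  have key : ∀ {a b : ℤ} {u v : ℝ}, |a - b| ≤ 1 → (a * η ≤ v ∧ v < (a + 1) * η) →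
      (b * η ≤ u ∧ u < (b + 1) * η) → |u - v| ≤ 2 * η := by
    intro a b u v hab hv hu
    rw [abs_le] at hab
    have e1 : (a : ℝ) ≤ b + 1 := by exact_mod_cast (by omega : a ≤ b + 1)
    have e2 : (b : ℝ) ≤ a + 1 := by exact_mod_cast (by omega : b ≤ a + 1)
    have e1 := mul_le_mul_of_nonneg_right e1 hη.le
    have e2 := mul_le_mul_of_nonneg_right e2 hη.le
    rw [abs_le]
    constructor <;> linarith
  have hdist : dist p y ≤ 3 * η :=
    dist_le_of_abs_le (key hi1 hy.1 hpj.1) (key hi2 hy.2 hpj.2) (by positivity) (by nlinarith)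
  exact Set.mem_biUnion (x := y) (show φ {y} ≠ 0 from (zero_lt_one.trans_le hy1).ne') hdist

/-- An infinite cluster of good cells forces percolation of the Boolean model. -/
lemma percolates_of_infinite_goodCluster (hη : 0 < η) (hL : 2 ≤ L)
    (hheavy : ∀ x i, 1 ≤ c {x} → ((9 * (41 * L) : ℕ) : ℝ≥0∞)⁻¹ ≤
        (annUnif (2 * L * η) (η / 2)).map (fun z => x + z) (cell η i) → ℓ ≤ m (cell η i))
    (hfin : ∀ i, m (cell η i) < ∞)
    (hc : ∀ z, c (cell (L * η) z) ≠ 0 → ∃ x ∈ cell (L * η) z, 1 ≤ c {x})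
    (hφ : ∀ i, φ (cell η i) ≠ 0 → ∃ y ∈ cell η i, 1 ≤ φ {y})
    (hinf : ¬ (goodCluster fun p : ℕ × ℕ => ¬ (c (cell (L * η) (p.1, p.2)) = 0 ∨
      ∃ w ∈ nbhd (p.1, p.2), HasEmptyHeavySquare η L ℓ m φ w)).Finite) :
    Percolates (BooleanModel φ (3 * η)) := by
  set good : ℕ × ℕ → Prop := fun p => ¬ (c (cell (L * η) (p.1, p.2)) = 0 ∨
      ∃ w ∈ nbhd (p.1, p.2), HasEmptyHeavySquare η L ℓ m φ w) with hgood
  set C := goodCluster good with hC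
  have hL0 : (0 : ℝ) < L := by exact_mod_cast (by omega : 0 < L)
  have hs : 0 < L * η := by positivity
  have hR : 0 ≤ 2 * L * η := by positivity
  have h0 : good (0, 0) := by
    refine Classical.by_contradiction fun h0 => ?_
    refine hinf ((Set.finite_singleton (0, 0)).subset fun p hp => ?_)
    rcases Relation.ReflTransGen.cases_head hp with h | ⟨q, h, -⟩
    · exact h.symm
    · exact absurd h.2.1 h0
  have hCgood : ∀ p ∈ C, good p := by
    intro p hp
    rcases Relation.ReflTransGen.cases_tail hp with h | ⟨q, -, h⟩
    · rw [h]; exact h0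
    · exact h.2.2
  have hcenter : ∀ p : ℕ × ℕ, ∃ x, p ∈ C → x ∈ cell (L * η) (p.1, p.2) ∧ 1 ≤ c {x} := by
    intro p
    by_cases hp : p ∈ C
    · obtain ⟨x, hx, hx1⟩ := hc (p.1, p.2) fun h => hCgood p hp (.inl h)
      exact ⟨x, fun _ => ⟨hx, hx1⟩⟩
    · exact ⟨0, fun h => absurd h hp⟩
  choose x hx using hcenter
  have hsub : ∀ p ∈ C, sphere (x p) (2 * L * η) ⊆ BooleanModel φ (3 * η) := by
    intro p hp
    refine sphere_subset_booleanModel hη hL (hx p hp).1 (fun i => hheavy _ i (hx p hp).2) hfin hφ ?_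
    intro w hw h
    exact hCgood p hp (.inr ⟨w, hw, h⟩)
  have hmeet : ∀ p ∈ C, ∀ q ∈ C, NearestAdj p q →
      (sphere (x p) (2 * L * η) ∩ sphere (x q) (2 * L * η)).Nonempty := by
    intro p hp q hq hpq
    refine sphere_inter_nonempty hR ?_
    have h1 := (hx p hp).1
    have h2 := (hx q hq).1
    rw [mem_cell_iff hs] at h1 h2
    have key : ∀ {a b : ℕ} {u v : ℝ}, a ≤ b + 1 → b ≤ a + 1 →
        (((a : ℤ) : ℝ) * (L * η) ≤ u ∧ u < ((a : ℤ) + 1) * (L * η)) →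
        (((b : ℤ) : ℝ) * (L * η) ≤ v ∧ v < ((b : ℤ) + 1) * (L * η)) →
        |u - v| ≤ 2 * (L * η) := by
      intro a b u v e1 e2 hu hv
      have e1 : (a : ℝ) ≤ b + 1 := by exact_mod_cast e1
      have e2 : (b : ℝ) ≤ a + 1 := by exact_mod_cast e2
      have e1 := mul_le_mul_of_nonneg_right e1 hs.le
      have e2 := mul_le_mul_of_nonneg_right e2 hs.le
      simp only [Int.cast_natCast] at hu hv
      rw [abs_le]
      constructor <;> linarith
    unfold NearestAdj at hpq
    exact dist_le_of_abs_le (key (by omega) (by omega) h1.1 h2.1)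
      (key (by omega) (by omega) h1.2 h2.2) (by positivity) (by nlinarith)
  have hrank : 1 < Module.rank ℝ E2 := by
    rw [rank_eq_card_basis (EuclideanSpace.basisFun (Fin 2) ℝ).toBasis]; norm_num
  refine ⟨⋃ p ∈ C, sphere (x p) (2 * L * η), Set.iUnion₂_subset hsub, ?_, ?_⟩
  · refine IsConnected.biUnion_of_reflTransGen ⟨(0, 0), Relation.ReflTransGen.refl⟩
      (fun p _ => isConnected_sphere hrank _ hR) ?_
    have hboth : ∀ p ∈ C,
        Relation.ReflTransGen (fun p q => (sphere (x p) (2 * L * η) ∩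
          sphere (x q) (2 * L * η)).Nonempty ∧ p ∈ C) (0, 0) p ∧
        Relation.ReflTransGen (fun p q => (sphere (x p) (2 * L * η) ∩
          sphere (x q) (2 * L * η)).Nonempty ∧ p ∈ C) p (0, 0) := by
      intro p hp
      induction hp with
      | refl => exact ⟨.refl, .refl⟩
      | @tail q p hq hqp ih =>
        have hp : p ∈ C := Relation.ReflTransGen.tail hq hqp
        exact ⟨ih.1.tail ⟨hmeet q hq p hp hqp.1, hq⟩,
          ih.2.head ⟨hmeet p hp q hq hqp.1.symm, hp⟩⟩
    exact fun p hp q hq => (hboth p hp).2.trans (hboth q hq).1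
  · intro hbdd
    obtain ⟨M, hM⟩ := hbdd.subset_closedBall (0 : E2)
    obtain ⟨n, hn⟩ := exists_nat_ge ((M + 2 * L * η) / (L * η))
    rw [div_le_iff₀ hs] at hn
    refine hinf (((Set.finite_Iic n).prod (Set.finite_Iic n)).subset fun p hp => ?_)
    obtain ⟨y, hy⟩ := (isConnected_sphere hrank (x p) hR).nonempty
    have hyM : dist y 0 ≤ M := hM (Set.mem_biUnion hp hy)
    have hxn : dist (x p) 0 ≤ n * (L * η) := by
      have := dist_triangle_left (x p) 0 y
      rw [mem_sphere] at hy
      linarith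
    have hxc := (hx p hp).1
    rw [mem_cell_iff hs] at hxc
    simp only [Int.cast_natCast] at hxc
    have e1 := (le_abs_self _).trans ((abs_coord_le_dist (x p) 0 0).trans hxn)
    have e2 := (le_abs_self _).trans ((abs_coord_le_dist (x p) 0 1).trans hxn)
    simp only [PiLp.zero_apply, sub_zero] at e1 e2
    exact ⟨by exact_mod_cast le_of_mul_le_mul_right (hxc.1.1.trans e1) hs,
      by exact_mod_cast le_of_mul_le_mul_right (hxc.2.1.trans e2) hs⟩

end Deterministic

section Driving

variable {μ R δ : ℝ} {c m : Measure E2}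

lemma driving_ge (hm : ∀ B : Set E2, MeasurableSet B → m B = ENNReal.ofReal μ *
      ∫⁻ x, ((annUnif R δ).map fun z => x + z) B ∂c)
    {B : Set E2} (hB : MeasurableSet B) {x : E2} (hx : 1 ≤ c {x}) :
    ENNReal.ofReal μ * ((annUnif R δ).map fun z => x + z) B ≤ m B := by
  rw [hm B hB]
  gcongr
  calc _ ≤ ((annUnif R δ).map fun z => x + z) B * c {x} := le_mul_of_one_le_right' hx
    _ = ∫⁻ y in {x}, ((annUnif R δ).map fun z => y + z) B ∂c := by rw [lintegral_singleton]
    _ ≤ _ := setLIntegral_le_lintegral _ _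

lemma driving_lt_top (hm : ∀ B : Set E2, MeasurableSet B → m B = ENNReal.ofReal μ *
      ∫⁻ x, ((annUnif R δ).map fun z => x + z) B ∂c)
    {B : Set E2} (hB : MeasurableSet B) {M : ℝ} (hBM : B ⊆ closedBall 0 M)
    (hc : c (closedBall 0 (M + R)) < ∞) : m B < ∞ := by
  rw [hm B hB]
  refine ENNReal.mul_lt_top ENNReal.ofReal_lt_top (lt_of_le_of_lt ?_ hc)
  calc _ ≤ ∫⁻ x, (closedBall 0 (M + R)).indicator 1 x ∂c := by
        refine lintegral_mono fun x => ?_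
        rw [Measure.map_apply (measurable_const_add x) hB]
        by_cases hx : x ∈ closedBall 0 (M + R)
        · rw [Set.indicator_of_mem hx]
          exact annUnif_le_one _
        · rw [annUnif_apply]
          have : (fun z => x + z) ⁻¹' B ∩ annulus R δ = ∅ := by
            refine Set.eq_empty_of_forall_notMem fun y hy => hx ?_
            have h1 : ‖x + y‖ ≤ M := by simpa using hBM hy.1
            have h2 : ‖y‖ ≤ R := by simpa using hy.2.1
            have h3 := norm_sub_le (x + y) y
            rw [add_sub_cancel_right] at h3
            simpa using h3.trans (add_le_add h1 h2)
          simp [this]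
    _ = _ := lintegral_indicator_one measurableSet_closedBall

end Driving

section EmptyHeavySquares

variable {Ω : Type*} [MeasurableSpace Ω] {P : Measure Ω} [IsProbabilityMeasure P]
  {Φ Λ : Ω → Measure E2} {η : ℝ} {L : ℕ}

lemma mul_add_fin_inj {v w : ℤ} {a b : Fin L} (h : v * L + (a : ℕ) = w * L + (b : ℕ)) :
    v = w := by
  have hL : (0 : ℤ) < L := by exact_mod_cast (Nat.zero_le _).trans_lt a.2
  have ha : ((a : ℕ) : ℤ) < L := by exact_mod_cast a.2
  have hb : ((b : ℕ) : ℤ) < L := by exact_mod_cast b.2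
  have h1 : (v * L + (a : ℕ)) / L = v := by
    rw [Int.add_comm, Int.add_mul_ediv_right _ _ hL.ne', Int.ediv_eq_zero_of_lt (by omega) ha,
      zero_add]
  have h2 : (w * L + (b : ℕ)) / L = w := by
    rw [Int.add_comm, Int.add_mul_ediv_right _ _ hL.ne', Int.ediv_eq_zero_of_lt (by omega) hb,
      zero_add]
  rw [← h1, ← h2, h]

lemma IsCoxPP.measure_hasEmptyHeavySquare_le (h : IsCoxPP P Φ Λ) (hη : 0 < η) (l : ℝ)
    (T : Finset (ℤ × ℤ)) :
    P {ω | ∀ w ∈ T, HasEmptyHeavySquare η L (ENNReal.ofReal l) (Λ ω) (Φ ω) w}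
      ≤ (ENNReal.ofReal (L ^ 2 * Real.exp (-l))) ^ T.card := by
  let sq : (g : T → Fin L × Fin L) → T → ℤ × ℤ := fun g t =>
    (t.1.1 * L + ((g t).1 : ℕ), t.1.2 * L + ((g t).2 : ℕ))
  have hsub : {ω | ∀ w ∈ T, HasEmptyHeavySquare η L (ENNReal.ofReal l) (Λ ω) (Φ ω) w} ⊆
      ⋃ g : T → Fin L × Fin L, {ω | ∀ t ∈ Finset.univ, ENNReal.ofReal l ≤ Λ ω (cell η (sq g t)) ∧
        Λ ω (cell η (sq g t)) < ∞ ∧ Φ ω (cell η (sq g t)) = 0} := by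
    intro ω hω
    choose a b hab using fun t : T => hω t.1 t.2
    exact Set.mem_iUnion.2 ⟨fun t => (a t, b t), fun t _ => hab t⟩
  refine (measure_mono hsub).trans ((measure_iUnion_fintype_le _ _).trans ?_)
  refine (Finset.sum_le_sum fun g _ => h.void_prob_le Finset.univ (fun t => cell η (sq g t))
    (fun _ => measurableSet_cell _ _) (fun _ => isBounded_cell hη _) ?_ l).trans ?_
  · intro t _ t' _ htt'
    refine disjoint_cell fun heq => htt' (Subtype.ext (Prod.ext ?_ ?_))
    · exact mul_add_fin_inj (congrArg Prod.fst heq)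
    · exact mul_add_fin_inj (congrArg Prod.snd heq)
  · rw [Finset.sum_const, Finset.card_univ, Finset.card_univ, Fintype.card_coe, nsmul_eq_mul,
      Fintype.card_fun, Fintype.card_prod, Fintype.card_fin, Fintype.card_coe,
      ENNReal.ofReal_mul (by positivity)]
    refine le_of_eq ?_
    rw [ENNReal.ofReal_pow (by positivity), ENNReal.ofReal_natCast]
    push_cast
    rw [pow_two]
    simp only [mul_pow]

end EmptyHeavySquares

lemma exists_squares_per_side {c : ℝ} (hc : 0 < c) {ε : ℝ≥0∞} (hε : 0 < ε) :
    ∃ L : ℕ, 2 ≤ L ∧ ENNReal.ofReal (L ^ 2 * Real.exp (-(c * L))) ≤ ε := by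
  have h1 : Filter.Tendsto (fun L : ℕ => (c ^ 2)⁻¹ * ((c * L) ^ 2 * Real.exp (-(c * L))))
      Filter.atTop (nhds ((c ^ 2)⁻¹ * 0)) :=
    ((Real.tendsto_pow_mul_exp_neg_atTop_nhds_zero 2).comp
      (tendsto_natCast_atTop_atTop.const_mul_atTop hc)).const_mul _
  have h2 := ENNReal.tendsto_ofReal h1
  rw [mul_zero, ENNReal.ofReal_zero] at h2
  obtain ⟨L, hL, hL2⟩ := ((h2.eventually_lt_const hε).and (Filter.eventually_ge_atTop 2)).exists
  refine ⟨L, hL2, le_trans (le_of_eq ?_) hL.le⟩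
  congr 1
  field_simp

lemma criticalRadius_le {Ω : Type*} [MeasurableSpace Ω] {P : Measure Ω} {Φ : Ω → Measure E2}
    {r : ℝ} (h : 0 < P {ω | Percolates (BooleanModel (Φ ω) r)}) : criticalRadius P Φ ≤ r := by
  refine csInf_le ⟨0, fun t ht => ?_⟩ h
  by_contra! h0
  refine LT.lt.ne' (show 0 < P {ω | Percolates (BooleanModel (Φ ω) t)} from ht) ?_
  convert measure_empty (μ := P)
  refine Set.eq_empty_of_forall_notMem fun ω hω => ?_
  obtain ⟨C, hC, hconn, -⟩ := hω
  obtain ⟨y, hy⟩ := hconn.nonempty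
  simpa [BooleanModel, closedBall_eq_empty.2 h0] using hC hy

section Percolation

variable {Ω : Type*} [MeasurableSpace Ω] {P : Measure Ω} [IsProbabilityMeasure P]
  {Φc Λ Φ : Ω → Measure E2}

lemma IsPoissonPP.measure_empty_cells_le {α h : ℝ}
    (hΦc : IsPoissonPP P Φc (ENNReal.ofReal α • (volume : Measure E2))) (hα : 0 ≤ α) (hh : 0 < h)
    (T : Finset (ℤ × ℤ)) :
    P {ω | ∀ z ∈ T, Φc ω (cell h z) = 0} ≤
      ENNReal.ofReal (Real.exp (-(α * h ^ 2))) ^ T.card := by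
  refine le_trans (measure_mono ?_) (hΦc.isCoxPP.void_prob_le T (cell h)
    (fun _ => measurableSet_cell _ _) (fun _ => isBounded_cell hh _)
    (fun z _ w _ hzw => disjoint_cell hzw) (α * h ^ 2))
  intro ω hω z hz
  have : (ENNReal.ofReal α • (volume : Measure E2)) (cell h z) = ENNReal.ofReal (α * h ^ 2) := by
    rw [Measure.smul_apply, volume_cell hh, smul_eq_mul, ENNReal.ofReal_mul hα]
  exact ⟨this.ge, this.trans_lt ENNReal.ofReal_lt_top, hω z hz⟩

/-- The driving measure of a Cox cluster process almost surely charges every cell finitely. -/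
lemma ae_driving_cell_lt_top {m : Measure E2} {μ R δ η : ℝ} (hη : 0 < η)
    (hΦc : IsPoissonPP P Φc m)
    (hΛ : ∀ᵐ ω ∂P, ∀ B : Set E2, MeasurableSet B → Λ ω B = ENNReal.ofReal μ *
      ∫⁻ x, ((annUnif R δ).map fun z => x + z) B ∂(Φc ω)) :
    ∀ᵐ ω ∂P, ∀ i, Λ ω (cell η i) < ∞ := by
  have hfin : ∀ᵐ ω ∂P, ∀ n : ℕ, Φc ω (closedBall 0 n) < ∞ := by
    refine ae_all_iff.2 fun n => ?_
    filter_upwards [hΦc.isCoxPP.ae_natCast (B := closedBall 0 n) measurableSet_closedBall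
      isBounded_closedBall]
      with ω ⟨k, hk⟩
    rw [hk]
    exact ENNReal.natCast_lt_top k
  filter_upwards [hΛ, hfin] with ω hω hωfin i
  obtain ⟨M, hM⟩ := (isBounded_cell hη i).subset_closedBall 0
  obtain ⟨n, hn⟩ := exists_nat_ge (M + R)
  exact driving_lt_top hω (measurableSet_cell _ _) hM
    ((measure_mono (closedBall_subset_closedBall hn)).trans_lt (hωfin n))

lemma measure_percolates_pos {α μ η : ℝ} {L : ℕ} (hη : 0 < η) (hL : 2 ≤ L) (hα : 0 ≤ α)
    (hμ : 0 ≤ μ)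
    (hcenter : ENNReal.ofReal (Real.exp (-(α * (L * η) ^ 2))) ≤ epsCenter ^ 2)
    (hsquare : ENNReal.ofReal (L ^ 2 * Real.exp (-(μ * (9 * (41 * L) : ℝ)⁻¹))) ≤ epsSquare ^ 98)
    (hΦc : IsPoissonPP P Φc (ENNReal.ofReal α • (volume : Measure E2)))
    (hΛ : ∀ᵐ ω ∂P, ∀ B : Set E2, MeasurableSet B → Λ ω B = ENNReal.ofReal μ *
      ∫⁻ x, ((annUnif (2 * L * η) (η / 2)).map fun z => x + z) B ∂(Φc ω))
    (hΦ : IsCoxPP P Φ Λ) :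
    0 < P {ω | Percolates (BooleanModel (Φ ω) (3 * η))} := by
  have hL0 : (0 : ℝ) < L := by exact_mod_cast (by omega : 0 < L)
  have hs : 0 < L * η := by positivity
  set ℓ := ENNReal.ofReal (μ * (9 * (41 * L) : ℝ)⁻¹) with hℓ
  have hlt := measure_goodCluster_finite_lt_one (P := P)
    (E := fun z ω => Φc ω (cell (L * η) z) = 0)
    (G := fun w ω => HasEmptyHeavySquare η L ℓ (Λ ω) (Φ ω) w)
    (fun T => (hΦc.measure_empty_cells_le hα hs T).trans (pow_le_pow_left' hcenter _))
    (fun T => (hΦ.measure_hasEmptyHeavySquare_le hη _ T).trans (pow_le_pow_left' hsquare _))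
  rw [pos_iff_ne_zero]
  intro h0
  refine hlt.ne ((measure_congr (Filter.eventuallyEq_univ.2 ?_)).trans measure_univ)
  have h0 : ∀ᵐ ω ∂P, ¬ Percolates (BooleanModel (Φ ω) (3 * η)) := by
    rw [ae_iff]; simpa using h0
  filter_upwards [h0, hΛ, ae_driving_cell_lt_top hη hΦc hΛ,
    hΦc.isCoxPP.ae_exists_atom (cell (L * η)) (measurableSet_cell _) (isBounded_cell hs),
    hΦ.ae_exists_atom (cell η) (measurableSet_cell _) (isBounded_cell hη)]
    with ω hω hform hfin hc hφ
  refine Classical.by_contradiction fun hinf => hω ?_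
  refine percolates_of_infinite_goodCluster hη hL (fun x i hx hi => ?_) hfin hc hφ hinf
  refine le_trans ?_ (driving_ge hform (measurableSet_cell _ _) hx)
  rw [hℓ, ENNReal.ofReal_mul hμ]
  gcongr
  refine le_trans (le_of_eq ?_) hi
  rw [ENNReal.ofReal_inv_of_pos (by positivity)]
  congr 1
  rw [← ENNReal.ofReal_natCast]
  push_cast
  rfl

end Percolation

/-- for arbitrarily small `a, r > 0` one can choose parameters
`0 < α, μ, δ, R < ∞` with `αμ = a` such that every Poisson-Poisson cluster point
process `Φ_α^{R,δ,μ}` with annular clusters (a Cox process whose driving measure is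
`Λ = μ Σ_{X ∈ Φ_α} 𝒳(X, · − X)`, with `Φ_α` Poisson of intensity `α` and `𝒳(x,·)`
uniform on the annulus of radii `R−δ, R` around `x`) has critical radius
`r_c(Φ_α^{R,δ,μ}) ≤ r`. -/
theorem cox_annular_cluster_small_critical_radius :
    ∀ a r : ℝ, 0 < a → 0 < r →
    ∃ α μ δ R : ℝ, 0 < α ∧ 0 < μ ∧ 0 < δ ∧ δ ≤ R ∧ α * μ = a ∧
      ∀ (Ω : Type) [MeasurableSpace Ω] (P : Measure Ω) [IsProbabilityMeasure P]
        (Φc Λ Φ : Ω → Measure E2),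
        -- `Φc` is the Poisson process of cluster centers, of intensity `α`
        IsPoissonPP P Φc (ENNReal.ofReal α • (volume : Measure E2)) →
        -- `Λ = μ Σ_{X ∈ Φc} 𝒳(X, · − X)` is the random driving measure
        (∀ᵐ ω ∂P, ∀ B : Set E2, MeasurableSet B →
          Λ ω B = ENNReal.ofReal μ *
            ∫⁻ x, (Measure.map (fun z => x + z) (annUnif R δ)) B ∂(Φc ω)) →
        -- `Φ` is the Cox process directed by `Λ`
        IsCoxPP P Φ Λ →
        criticalRadius P Φ ≤ r := by
  intro a r ha hr
  obtain ⟨η, hη, rfl⟩ : ∃ η, 0 < η ∧ r = 3 * η := ⟨r / 3, by positivity, by ring⟩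
  set K := Real.log 40000 with hK
  have hK0 : 0 < K := Real.log_pos (by norm_num)
  obtain ⟨L, hL, hLε⟩ := exists_squares_per_side (c := a * η ^ 2 / (369 * K)) (by positivity)
    (ε := epsSquare ^ 98) (ENNReal.pow_pos (by simp [epsSquare, ENNReal.mul_eq_top]) _)
  have hL0 : (0 : ℝ) < L := by exact_mod_cast (by omega : 0 < L)
  have hL2 : (2 : ℝ) ≤ L := by exact_mod_cast hL
  refine ⟨K / (L * η) ^ 2, a * (L * η) ^ 2 / K, η / 2, 2 * L * η, by positivity, by positivity,
    by positivity, by nlinarith, by field_simp, ?_⟩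
  intro Ω _ P _ Φc Λ Φ hΦc hΛ hΦ
  refine criticalRadius_le (measure_percolates_pos hη hL (by positivity) (by positivity) ?_ ?_
    hΦc hΛ hΦ)
  · rw [div_mul_cancel₀ _ (by positivity), Real.exp_neg, hK, Real.exp_log (by norm_num),
      ENNReal.ofReal_inv_of_pos (by norm_num), epsCenter, ← ENNReal.inv_pow]
    norm_num
  · convert hLε using 5
    field_simp
    norm_num
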